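/- For every z ∈ ℂ with y = Im z > 0: (i) G_l(z) = 0 for every odd integer l; (ii) Σ_{s ∈ ℤ} |G_{2s}(z)|² = Im G₀(z)/y. -/

import Mathlib

open Real Complex

/-- The matrix entries of the resolvent of the Toeplitz operator with symbol
`a + c·cos 2φ`, where `a = cos²(θ/2)`, `c = sin²(θ/2)`. -/
noncomputable def Gres (θ : ℝ) (l : ℤ) (z : ℂ) : ℂ :=
  (1 / (2 * π)) * ∫ φ in (-π)..π,
    Complex.exp (Complex.I * l * φ) /
      ((Real.cos (θ / 2) ^ 2 : ℝ) - z + (Real.sin (θ / 2) ^ 2 : ℝ) * Real.cos (2 * φ))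

/-- The symbol `a - z + c·cos 2φ` of the shifted operator. -/
noncomputable def shiftedSymbol (θ : ℝ) (z : ℂ) (φ : ℝ) : ℂ :=
  (Real.cos (θ / 2) ^ 2 : ℝ) - z + (Real.sin (θ / 2) ^ 2 : ℝ) * Real.cos (2 * φ)

lemma shiftedSymbol_im (θ : ℝ) (z : ℂ) (φ : ℝ) : (shiftedSymbol θ z φ).im = -z.im := by
  simp only [shiftedSymbol, ← Complex.ofReal_mul, Complex.add_im, Complex.sub_im,
    Complex.ofReal_im]
  ring

lemma shiftedSymbol_ne_zero (θ : ℝ) {z : ℂ} (hz : z.im ≠ 0) (φ : ℝ) :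
    shiftedSymbol θ z φ ≠ 0 := fun h => by
  have := shiftedSymbol_im θ z φ
  rw [h, Complex.zero_im] at this
  exact hz (by linarith)

lemma shiftedSymbol_add_pi (θ : ℝ) (z : ℂ) (φ : ℝ) :
    shiftedSymbol θ z (φ + π) = shiftedSymbol θ z φ := by
  simp only [shiftedSymbol, mul_add, Real.cos_add_two_pi]

lemma continuous_shiftedSymbol (θ : ℝ) (z : ℂ) : Continuous (shiftedSymbol θ z) := by
  unfold shiftedSymbol
  fun_prop

lemma continuous_inv_shiftedSymbol (θ : ℝ) {z : ℂ} (hz : z.im ≠ 0) :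
    Continuous fun φ => (shiftedSymbol θ z φ)⁻¹ :=
  (continuous_shiftedSymbol θ z).inv₀ (shiftedSymbol_ne_zero θ hz)

lemma inv_shiftedSymbol_im (θ : ℝ) (z : ℂ) (φ : ℝ) :
    (shiftedSymbol θ z φ)⁻¹.im = z.im * ‖(shiftedSymbol θ z φ)⁻¹‖ ^ 2 := by
  rw [Complex.inv_im, shiftedSymbol_im, neg_neg, norm_inv, inv_pow, Complex.sq_norm,
    div_eq_mul_inv]

lemma Gres_eq_integral (θ : ℝ) (l : ℤ) (z : ℂ) :
    Gres θ l z = (1 / (2 * π)) * ∫ φ in (-π)..π,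
      Complex.exp (Complex.I * l * φ) * (shiftedSymbol θ z φ)⁻¹ := rfl

lemma exp_I_mul_intCast_mul_add_pi {l : ℤ} (hl : Odd l) (φ : ℝ) :
    Complex.exp (Complex.I * l * ((φ + π : ℝ) : ℂ)) = -Complex.exp (Complex.I * l * φ) := by
  have h : Complex.exp (l * (π * Complex.I)) = -1 := by
    rw [Complex.exp_int_mul, Complex.exp_pi_mul_I, hl.neg_one_zpow]
  rw [show Complex.I * l * ((φ + π : ℝ) : ℂ) = Complex.I * l * φ + l * (π * Complex.I) by
    push_cast; ring, Complex.exp_add, h, mul_neg_one]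

lemma Function.Antiperiodic.intervalIntegral_eq_zero {f : ℝ → ℂ} {T : ℝ}
    (hf : Function.Antiperiodic f T) : ∫ x in (-T)..T, f x = 0 := by
  have h1 : ∫ x in (-T)..T, f (x + T) = ∫ x in (-T)..T, f x := by
    rw [intervalIntegral.integral_comp_add_right]
    have := hf.periodic_two_mul.intervalIntegral_add_eq (-T + T) (-T)
    convert this using 2 <;> ring
  simp only [hf _, intervalIntegral.integral_neg] at h1
  exact self_eq_neg.mp h1.symm

lemma Gres_eq_zero_of_odd (θ : ℝ) {l : ℤ} (hl : Odd l) (z : ℂ) : Gres θ l z = 0 := by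
  rw [Gres_eq_integral, Function.Antiperiodic.intervalIntegral_eq_zero, mul_zero]
  intro φ
  beta_reduce
  rw [exp_I_mul_intCast_mul_add_pi hl, shiftedSymbol_add_pi, neg_mul]

lemma Gres_eq_fourierCoeffOn (θ : ℝ) (l : ℤ) (z : ℂ) (h : -π < π) :
    Gres θ l z = fourierCoeffOn h (fun φ => (shiftedSymbol θ z φ)⁻¹) (-l) := by
  rw [Gres_eq_integral, fourierCoeffOn_eq_integral, Complex.real_smul]
  congr 1
  · push_cast
    ring
  · refine intervalIntegral.integral_congr fun φ _ => ?_
    simp only [neg_neg, fourier_coe_apply, smul_eq_mul]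
    congr 2
    have : (π : ℂ) ≠ 0 := Complex.ofReal_ne_zero.mpr Real.pi_ne_zero
    push_cast
    field_simp
    ring

lemma Gres_zero_im (θ : ℝ) {z : ℂ} (hz : z.im ≠ 0) :
    (Gres θ 0 z).im = z.im * ((2 * π)⁻¹ * ∫ φ in (-π)..π, ‖(shiftedSymbol θ z φ)⁻¹‖ ^ 2) := by
  have h := intervalIntegral.intervalIntegral_im (𝕜 := ℂ)
    ((continuous_inv_shiftedSymbol θ hz).intervalIntegrable (μ := MeasureTheory.volume) (-π) π)
  simp only [RCLike.im_eq_complex_im, inv_shiftedSymbol_im,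
    intervalIntegral.integral_const_mul] at h
  rw [Gres_eq_integral, show (1 / (2 * π) : ℂ) = (((2 * π)⁻¹ : ℝ) : ℂ) by push_cast; ring,
    Complex.im_ofReal_mul]
  simp only [Int.cast_zero, mul_zero, zero_mul, Complex.exp_zero, one_mul]
  rw [← h]
  ring

lemma tsum_sq_norm_Gres (θ : ℝ) {z : ℂ} (hz : z.im ≠ 0) :
    ∑' l : ℤ, ‖Gres θ l z‖ ^ 2 =
      (2 * π)⁻¹ * ∫ φ in (-π)..π, ‖(shiftedSymbol θ z φ)⁻¹‖ ^ 2 := by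
  have hπ : -π < π := by linarith [Real.pi_pos]
  have hL2 : MeasureTheory.MemLp (fun φ => (shiftedSymbol θ z φ)⁻¹) 2
      (MeasureTheory.volume.restrict (Set.Ioc (-π) π)) :=
    (MeasureTheory.memLp_two_iff_integrable_sq_norm
      (continuous_inv_shiftedSymbol θ hz).aestronglyMeasurable).mpr
        ((continuous_inv_shiftedSymbol θ hz).norm.pow 2).integrableOn_Ioc
  have h := tsum_sq_fourierCoeffOn hπ hL2
  rw [← (Equiv.neg ℤ).tsum_eq] at h
  simp only [Equiv.neg_apply, ← Gres_eq_fourierCoeffOn] at h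
  rw [h, smul_eq_mul, sub_neg_eq_add, two_mul]

/-- For every `z` with `y = Im z > 0`: (i) `G_l(z) = 0` for every odd `l`;
(ii) `Σ_{s ∈ ℤ} |G_{2s}(z)|² = Im G₀(z)/y`. -/
theorem stmt_17 (θ : ℝ) (hθ0 : 0 < θ) (hθπ : θ < π) (z : ℂ) (hz : 0 < z.im) :
    (∀ l : ℤ, Odd l → Gres θ l z = 0) ∧
      ∑' s : ℤ, ‖Gres θ (2 * s) z‖ ^ 2 = (Gres θ 0 z).im / z.im := by
  refine ⟨fun l hl => Gres_eq_zero_of_odd θ hl z, ?_⟩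
  have hinj : Function.Injective fun s : ℤ => 2 * s := mul_right_injective₀ two_ne_zero
  rw [hinj.tsum_eq (f := fun l => ‖Gres θ l z‖ ^ 2), tsum_sq_norm_Gres θ hz.ne',
    Gres_zero_im θ hz.ne', mul_div_cancel_left₀ _ hz.ne']
  intro l hl
  by_contra hmem
  refine hl ?_
  have hodd : Odd l := by
    rw [← Int.not_even_iff_odd, even_iff_exists_two_mul]
    rintro ⟨s, rfl⟩
    exact hmem ⟨s, rfl⟩
  simp [Gres_eq_zero_of_odd θ hodd]
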